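/- Assume P is irreducible. Then for every ℓ, j ∈ [n], the probability P_j[T ≤ T_j] is strictly positive and E_ℓ[∑_{t=0}^{T} 1{X_t = j}] = P_ℓ[∃ t : 0 ≤ t ≤ T and X_t = j] / P_j[T ≤ T_j], where T_j = min{t > 0 : X_t = j} (= +∞ if never), the sum over 0 ≤ t ≤ T includes t = T, and both sides are finite. -/

import Mathlib

open MeasureTheory Finset Filter
open scoped ENNReal NNReal ENat

noncomputable section

namespace RareTD

variable {n : ℕ}

/-- `P` is a row-stochastic matrix. -/
def IsStochastic (P : Matrix (Fin n) (Fin n) ℝ) : Prop :=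
  (∀ i j, 0 ≤ P i j) ∧ ∀ i, ∑ j, P i j = 1

/-- Irreducibility of a nonnegative matrix. -/
def IsIrreducible (P : Matrix (Fin n) (Fin n) ℝ) : Prop :=
  ∀ i j, ∃ m : ℕ, 0 < m ∧ 0 < (P ^ m) i j

/-- `Pr i` is the law of the Markov chain with transition matrix `P` started at `i`,
characterized by its finite-dimensional distributions. -/
def IsMarkovFamily (P : Matrix (Fin n) (Fin n) ℝ)
    (Pr : Fin n → Measure (ℕ → Fin n)) : Prop :=
  (∀ i, IsProbabilityMeasure (Pr i)) ∧
    ∀ (i : Fin n) (m : ℕ) (x : ℕ → Fin n),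
      (Pr i {ω | ∀ t ≤ m, ω t = x t}).toReal =
        (if x 0 = i then 1 else 0) * ∏ t ∈ Finset.range m, P (x t) (x (t + 1))

/-- The matrix `S` of the chain stopped on exiting `D`. -/
def stopMat (P : Matrix (Fin n) (Fin n) ℝ) (D : Finset (Fin n)) :
    Matrix (Fin n) (Fin n) ℝ :=
  fun i j => if i ∈ D then P i j else if i = j then 1 else 0

/-- Exit time `T = min {t ≥ 0 : ω t ∉ D}`, with value `⊤` if the path never leaves `D`. -/
def exitT (D : Finset (Fin n)) (ω : ℕ → Fin n) : ℕ∞ :=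
  ⨅ (t : ℕ) (_ : ω t ∉ D), (t : ℕ∞)

/-- Hitting time of a set at positive times, `min {t > 0 : ω t ∈ A}`. -/
def hitT (A : Set (Fin n)) (ω : ℕ → Fin n) : ℕ∞ :=
  ⨅ (t : ℕ) (_ : 0 < t ∧ ω t ∈ A), (t : ℕ∞)

/-- The stopped path `t ↦ X_{t ∧ T}`. -/
def stopped (D : Finset (Fin n)) (ω : ℕ → Fin n) : ℕ → Fin n
  | 0 => ω 0
  | t + 1 => if stopped D ω t ∈ D then ω (t + 1) else stopped D ω t

/-- `R_D`, the reward restricted to `D`. -/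
def RD (D : Finset (Fin n)) (R : Fin n → ℝ) : Fin n → ℝ := fun i => if i ∈ D then R i else 0

/-- The value function `u(i) = E_i[∑_{t=0}^{T} R(X_t)]`, in `[0,∞]`. -/
def valueE (Pr : Fin n → Measure (ℕ → Fin n)) (D : Finset (Fin n)) (R : Fin n → ℝ)
    (i : Fin n) : ℝ≥0∞ :=
  ∑' t : ℕ, ∫⁻ ω, Set.indicator {ω' : ℕ → Fin n | (t : ℕ∞) ≤ exitT D ω'}
      (fun ω' => ENNReal.ofReal (R (ω' t))) ω ∂(Pr i)

/-- The real-valued value function. -/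
def valueR (Pr : Fin n → Measure (ℕ → Fin n)) (D : Finset (Fin n)) (R : Fin n → ℝ)
    (i : Fin n) : ℝ := (valueE Pr D R i).toReal

/-- Replace by `0` every row and column with index outside `D`. -/
def zeroD (D : Finset (Fin n)) (M : Matrix (Fin n) (Fin n) ℝ) : Matrix (Fin n) (Fin n) ℝ :=
  fun i j => if i ∈ D ∧ j ∈ D then M i j else 0

/-- The asymptotic variance `σ_i²` of the LSTD estimator. -/
def avar (P : Matrix (Fin n) (Fin n) ℝ) (Pr : Fin n → Measure (ℕ → Fin n))
    (D : Finset (Fin n)) (R : Fin n → ℝ) (μ : Fin n → ℝ) (τ : ℕ) (i : Fin n) : ℝ :=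
  ∑ k ∈ D, (μ k)⁻¹ * ((((1 : Matrix (Fin n) (Fin n) ℝ) - zeroD D (stopMat P D ^ τ))⁻¹) i k) ^ 2 *
    ∫ ω, (∑ t ∈ Finset.range τ, RD D R (stopped D ω t)
        + valueR Pr D R (stopped D ω τ) - valueR Pr D R k) ^ 2 ∂(Pr k)

/-- Mean exit time `E_i[T] = ∑_{t≥0} P_i[T > t]`, in `[0,∞]`. -/
def meanExit (Pr : Fin n → Measure (ℕ → Fin n)) (D : Finset (Fin n)) (i : Fin n) : ℝ≥0∞ :=
  ∑' t : ℕ, Pr i {ω | (t : ℕ∞) < exitT D ω}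

/-- The event `T_ℓ^τ < min (T_k^τ, T_{Dᶜ∖{ℓ}}^τ)` for the `τ`-step chain. -/
def Qset (D : Finset (Fin n)) (k ℓ : Fin n) : Set (ℕ → Fin n) :=
  {ω | hitT {ℓ} ω < min (hitT {k} ω) (hitT ((D : Set (Fin n))ᶜ \ {ℓ}) ω)}

/-- Green's function of the `τ`-step chain: `E_i[∑_{t=0}^{T^τ-1} 1{Y_t^τ = k}]`. -/
def greenY (PrY : Fin n → Measure (ℕ → Fin n)) (D : Finset (Fin n)) (i k : Fin n) : ℝ≥0∞ :=
  ∑' t : ℕ, PrY i {ω | (t : ℕ∞) < exitT D ω ∧ ω t = k}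

/-- Green's function of the chain: `E_ℓ[∑_{t=0}^{T} 1{X_t = j}]` (the sum includes `t = T`). -/
def greenX (Pr : Fin n → Measure (ℕ → Fin n)) (D : Finset (Fin n)) (ℓ j : Fin n) : ℝ≥0∞ :=
  ∑' t : ℕ, Pr ℓ {ω | (t : ℕ∞) ≤ exitT D ω ∧ ω t = j}

/-- The cylinder of paths agreeing with `x` up to time `m`. -/
def cyl (m : ℕ) (x : ℕ → Fin n) : Set (ℕ → Fin n) := {ω | ∀ t ≤ m, ω t = x t}

/-- The path `ω` up to time `m`. -/
def initSeg (m : ℕ) (ω : ℕ → Fin n) : Fin (m + 1) → Fin n := fun s => ω s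

/-- The path started at time `t`. -/
def shift (t : ℕ) (ω : ℕ → Fin n) : ℕ → Fin n := fun s => ω (t + s)

/-- An event that depends only on the path up to time `t`. -/
def DependsUpTo (t : ℕ) (E : Set (ℕ → Fin n)) : Prop :=
  ∀ ω ω', (∀ s ≤ t, ω s = ω' s) → ω ∈ E → ω' ∈ E

lemma measurable_initSeg (m : ℕ) : Measurable (initSeg (n := n) m) := by
  unfold initSeg; fun_prop

lemma measurable_shift (m : ℕ) : Measurable (shift (n := n) m) := by
  unfold shift; fun_prop

lemma initSeg_preimage_singleton (m : ℕ) (ω : ℕ → Fin n) :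
    initSeg m ⁻¹' {initSeg m ω} = cyl m ω := by
  ext ω'
  simp only [Set.mem_preimage, Set.mem_singleton_iff, initSeg, cyl, Set.mem_ofPred_eq, funext_iff]
  exact ⟨fun h t ht => h ⟨t, by omega⟩, fun h s => h s (by omega)⟩

lemma exists_initSeg_eq {m : ℕ} (y : Fin (m + 1) → Fin n) :
    ∃ ω : ℕ → Fin n, initSeg m ω = y :=
  ⟨fun t => y (Fin.ofNat (m + 1) t), by ext s; simp [initSeg]⟩

lemma DependsUpTo.preimage_image {t : ℕ} {E : Set (ℕ → Fin n)} (hE : DependsUpTo t E) :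
    initSeg t ⁻¹' (initSeg t '' E) = E := by
  refine Set.Subset.antisymm ?_ (Set.subset_preimage_image _ _)
  rintro ω ⟨ω', h', he⟩
  refine hE ω' ω (fun s hs => ?_) h'
  exact congrFun he ⟨s, by omega⟩

lemma DependsUpTo.measurableSet {t : ℕ} {E : Set (ℕ → Fin n)} (hE : DependsUpTo t E) :
    MeasurableSet E := by
  rw [← hE.preimage_image]
  exact measurable_initSeg t (Set.toFinite _).measurableSet

lemma dependsUpTo_cyl (m : ℕ) (x : ℕ → Fin n) : DependsUpTo m (cyl m x) :=
  fun _ _ h hω t ht => (h t ht).symm.trans (hω t ht)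

/-- Two measures agree on an event of the past if they agree on the cylinders inside it. -/
lemma DependsUpTo.measure_eq {t : ℕ} {E : Set (ℕ → Fin n)} (hE : DependsUpTo t E)
    {μ ν : Measure (ℕ → Fin n)} (h : ∀ x ∈ E, μ (cyl t x) = ν (cyl t x)) : μ E = ν E := by
  classical
  have key : ∀ ρ : Measure (ℕ → Fin n),
      ρ E = ∑ y ∈ (Set.toFinite (initSeg t '' E)).toFinset, ρ (initSeg t ⁻¹' {y}) := by
    intro ρ
    rw [sum_measure_preimage_singleton _
      (fun y _ => measurable_initSeg t (measurableSet_singleton y))]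
    rw [Set.Finite.coe_toFinset, hE.preimage_image]
  rw [key μ, key ν]
  refine Finset.sum_congr rfl fun y hy => ?_
  rw [Set.Finite.mem_toFinset] at hy
  obtain ⟨ω, hω, rfl⟩ := hy
  rw [initSeg_preimage_singleton]
  exact h ω hω

/-- A finite measure on path space is determined by its values on cylinders. -/
lemma ext_of_cyl {μ ν : Measure (ℕ → Fin n)} [IsFiniteMeasure μ]
    (h : ∀ m x, μ (cyl m x) = ν (cyl m x)) : μ = ν := by
  refine ext_of_generate_finite {s | ∃ m x, s = cyl (n := n) m x} ?_ ?_ ?_ ?_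
  · refine le_antisymm ?_ (MeasurableSpace.generateFrom_le ?_)
    · refine iSup_le fun s => ?_
      rintro _ ⟨A, -, rfl⟩
      have hE : DependsUpTo s ((fun ω : ℕ → Fin n => ω s) ⁻¹' A) := by
        intro ω ω' h1 h2
        simpa [← h1 s le_rfl] using h2
      have : (fun ω : ℕ → Fin n => ω s) ⁻¹' A
          = ⋃ y ∈ initSeg s '' ((fun ω : ℕ → Fin n => ω s) ⁻¹' A), initSeg s ⁻¹' {y} := by
        conv_lhs => rw [← hE.preimage_image]
        ext ω; simp [eq_comm]
      rw [this]
      refine MeasurableSet.biUnion (Set.to_countable _) ?_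
      rintro _ ⟨ω, -, rfl⟩
      rw [initSeg_preimage_singleton]
      exact MeasurableSpace.measurableSet_generateFrom ⟨s, ω, rfl⟩
    · rintro _ ⟨m, x, rfl⟩
      exact (dependsUpTo_cyl m x).measurableSet
  · rintro _ ⟨m, x, rfl⟩ _ ⟨m', x', rfl⟩ ⟨ω, h1, h2⟩
    refine ⟨max m m', ω, ?_⟩
    ext ω'
    constructor
    · rintro ⟨h3, h4⟩ t ht
      rcases le_max_iff.1 ht with ht | ht
      · rw [h3 t ht, h1 t ht]
      · rw [h4 t ht, h2 t ht]
    · intro h3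
      exact ⟨fun t ht => (h3 t (le_max_of_le_left ht)).trans (h1 t ht),
        fun t ht => (h3 t (le_max_of_le_right ht)).trans (h2 t ht)⟩
  · rintro _ ⟨m, x, rfl⟩
    exact h m x
  · exact DependsUpTo.measure_eq (t := 0) (fun _ _ _ _ => trivial) fun x _ => h 0 x

section Markov

variable {P : Matrix (Fin n) (Fin n) ℝ} {Pr : Fin n → Measure (ℕ → Fin n)}

lemma IsMarkovFamily.measure_cyl (hPr : IsMarkovFamily P Pr) (hP : IsStochastic P) (i : Fin n)
    (m : ℕ) (x : ℕ → Fin n) :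
    Pr i (cyl m x) = (if x 0 = i then 1 else 0) *
      ∏ t ∈ Finset.range m, ENNReal.ofReal (P (x t) (x (t + 1))) := by
  have := hPr.1 i
  rw [← ENNReal.ofReal_toReal (measure_ne_top (Pr i) (cyl m x)),
    show (Pr i (cyl m x)).toReal = _ from hPr.2 i m x,
    ENNReal.ofReal_mul (by split_ifs <;> simp), ENNReal.ofReal_prod_of_nonneg fun t _ => hP.1 _ _]
  split_ifs <;> simp

/-- The Markov property at time `t`, on a cylinder. -/
lemma IsMarkovFamily.markov_cyl (hPr : IsMarkovFamily P Pr) (hP : IsStochastic P) (i : Fin n)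
    (t : ℕ) (x : ℕ → Fin n) :
    ((Pr i).restrict (cyl t x)).map (shift t) = Pr i (cyl t x) • Pr (x t) := by
  have := hPr.1 i
  refine ext_of_cyl fun m y => ?_
  rw [Measure.map_apply (measurable_shift t) (dependsUpTo_cyl m y).measurableSet,
    Measure.restrict_apply (measurable_shift t (dependsUpTo_cyl m y).measurableSet),
    Measure.smul_apply, smul_eq_mul]
  by_cases hy : y 0 = x t
  · have hset : shift t ⁻¹' cyl m y ∩ cyl t x
        = cyl (t + m) (fun s => if s ≤ t then x s else y (s - t)) := by
      ext ω
      constructor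
      · rintro ⟨h1, h2⟩ s hs
        dsimp only
        split_ifs with h
        · exact h2 s h
        · have := h1 (s - t) (by omega)
          rwa [shift, Nat.add_sub_cancel' (by omega)] at this
      · intro h
        refine ⟨fun s hs => ?_, fun s hs => by simpa [hs] using h s (by omega)⟩
        have := h (t + s) (by omega)
        rcases Nat.eq_zero_or_pos s with rfl | h0
        · simpa [shift, hy] using this
        · simpa [shift, h0.ne'] using this
    rw [hset, hPr.measure_cyl hP, hPr.measure_cyl hP, hPr.measure_cyl hP, Finset.prod_range_add,
      if_pos hy, one_mul, if_pos (Nat.zero_le t), mul_assoc]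
    congr 2
    · refine Finset.prod_congr rfl fun s hs => ?_
      have := Finset.mem_range.1 hs
      rw [if_pos (by omega), if_pos (by omega)]
    · refine Finset.prod_congr rfl fun s hs => ?_
      rw [if_neg (show ¬ t + s + 1 ≤ t by omega), show t + s + 1 - t = s + 1 by omega]
      rcases Nat.eq_zero_or_pos s with rfl | h0
      · simp [hy]
      · rw [if_neg (by omega), Nat.add_sub_cancel_left]
  · have hset : shift t ⁻¹' cyl m y ∩ cyl t x = ∅ := by
      refine Set.eq_empty_of_forall_notMem fun ω h => hy ?_
      rw [← h.1 0 (Nat.zero_le _), ← h.2 t le_rfl]; rfl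
    rw [hset, measure_empty, hPr.measure_cyl hP (x t), if_neg hy, zero_mul, mul_zero]

/-- The Markov property at time `t`. -/
lemma IsMarkovFamily.markov (hPr : IsMarkovFamily P Pr) (hP : IsStochastic P) (i k : Fin n)
    {t : ℕ} {E F : Set (ℕ → Fin n)} (hE : DependsUpTo t E) (hk : ∀ ω ∈ E, ω t = k)
    (hF : MeasurableSet F) :
    Pr i (E ∩ shift t ⁻¹' F) = Pr i E * Pr k F := by
  have hF' := measurable_shift t hF
  have : (Pr i).restrict (shift t ⁻¹' F) E = (Pr k F • Pr i) E := by
    refine hE.measure_eq fun x hx => ?_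
    have h := congrArg (fun μ => μ F) (hPr.markov_cyl hP i t x)
    simp only [Measure.map_apply (measurable_shift t) hF, Measure.restrict_apply hF',
      Measure.smul_apply, smul_eq_mul] at h
    rw [Measure.restrict_apply (dependsUpTo_cyl t x).measurableSet, Set.inter_comm, h, hk x hx,
      Measure.smul_apply, smul_eq_mul, mul_comm]
  rwa [Measure.restrict_apply hE.measurableSet, Measure.smul_apply, smul_eq_mul, mul_comm] at this

lemma measurableSet_eval_eq (t : ℕ) (k : Fin n) : MeasurableSet {ω : ℕ → Fin n | ω t = k} :=
  (measurable_pi_apply (X := fun _ : ℕ => Fin n) t) (measurableSet_singleton k)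

/-- Decomposition of an event according to the state at time `t`. -/
lemma measure_eq_sum_eval (μ : Measure (ℕ → Fin n)) (t : ℕ) (E : Set (ℕ → Fin n)) :
    μ E = ∑ k, μ (E ∩ {ω | ω t = k}) := by
  have := sum_measure_preimage_singleton (μ := μ.restrict E) Finset.univ
    (f := fun ω : ℕ → Fin n => ω t) (fun k _ => measurableSet_eval_eq t k)
  rw [Finset.coe_univ, Set.preimage_univ, Measure.restrict_apply_univ] at this
  rw [← this]
  refine Finset.sum_congr rfl fun k _ => ?_
  rw [Set.inter_comm]
  exact Measure.restrict_apply (measurableSet_eval_eq t k)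

lemma IsMarkovFamily.measure_start (hPr : IsMarkovFamily P Pr) (hP : IsStochastic P) (i k : Fin n) :
    Pr i {ω | ω 0 = k} = if k = i then 1 else 0 := by
  have := hPr.measure_cyl hP i 0 (fun _ => k)
  simpa [cyl] using this

lemma IsMarkovFamily.measure_step (hPr : IsMarkovFamily P Pr) (hP : IsStochastic P) (i k : Fin n) :
    Pr i {ω | ω 1 = k} = ENNReal.ofReal (P i k) := by
  have h0 : Pr i ({ω | ω 0 = i}ᶜ) = 0 := by
    have := hPr.1 i
    rw [prob_compl_eq_zero_iff (measurableSet_eval_eq 0 i), hPr.measure_start hP, if_pos rfl]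
  have := hPr.measure_cyl hP i 1 (fun s => if s = 0 then i else k)
  simp only [if_true, one_mul, Finset.range_one, Finset.prod_singleton, zero_add, one_ne_zero,
    if_false] at this
  rw [← this, ← measure_inter_conull h0]
  congr 1
  ext ω
  constructor
  · rintro ⟨h1, h2⟩ t ht
    interval_cases t
    · simpa using h2
    · simpa using h1
  · intro h
    exact ⟨by simpa using h 1 le_rfl, by simpa using h 0 zero_le_one⟩

/-- The law of the state at time `m` is given by the `m`-th power of the transition matrix. -/
lemma IsMarkovFamily.measure_eval (hPr : IsMarkovFamily P Pr) (hP : IsStochastic P) (i : Fin n)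
    (m : ℕ) (k : Fin n) : Pr i {ω | ω m = k} = ENNReal.ofReal ((P ^ m) i k) := by
  have hnn : ∀ m i k, 0 ≤ (P ^ m) i k := by
    intro m
    induction m with
    | zero => intro i k; rw [pow_zero, Matrix.one_apply]; split_ifs <;> simp
    | succ m ih =>
      intro i k
      rw [pow_succ, Matrix.mul_apply]
      exact Finset.sum_nonneg fun a _ => mul_nonneg (ih _ _) (hP.1 _ _)
  induction m generalizing k with
  | zero =>
    rw [hPr.measure_start hP, pow_zero, Matrix.one_apply]
    by_cases h : k = i
    · simp [h]
    · simp [h, Ne.symm h]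
  | succ m ih =>
    rw [measure_eq_sum_eval _ m, pow_succ, Matrix.mul_apply,
      ENNReal.ofReal_sum_of_nonneg fun a _ => mul_nonneg (hnn _ _ _) (hP.1 _ _)]
    refine Finset.sum_congr rfl fun a _ => ?_
    rw [ENNReal.ofReal_mul (hnn _ _ _), ← ih, ← hPr.measure_step hP, Set.inter_comm]
    refine hPr.markov hP i a (t := m) ?_ (fun ω h => h) (measurableSet_eval_eq 1 k)
    intro ω ω' h hω
    exact (h m le_rfl).symm.trans hω

end Markov

lemma le_exitT_iff {D : Finset (Fin n)} {ω : ℕ → Fin n} {t : ℕ} :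
    (t : ℕ∞) ≤ exitT D ω ↔ ∀ s < t, ω s ∈ D := by
  simp only [exitT, le_iInf_iff, Nat.cast_le]
  exact ⟨fun h s hs => by_contra fun h' => absurd (h s h') (by omega),
    fun h s hs => by_contra fun h' => hs (h s (by omega))⟩

/-- The event that the path stays in `D` strictly before time `t`. -/
def stays (D : Finset (Fin n)) (t : ℕ) : Set (ℕ → Fin n) := {ω | ∀ s < t, ω s ∈ D}

lemma dependsUpTo_stays (D : Finset (Fin n)) (t : ℕ) : DependsUpTo t (stays D t) :=
  fun _ _ h hω s hs => h s hs.le ▸ hω s hs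

lemma stays_antitone (D : Finset (Fin n)) : Antitone (stays D) :=
  fun _ _ hab _ hω s hs => hω s (hs.trans_le hab)

lemma stays_add (D : Finset (Fin n)) (t m : ℕ) :
    stays D (t + m) = stays D t ∩ shift t ⁻¹' stays D m := by
  ext ω
  constructor
  · exact fun h => ⟨fun s hs => h s (by omega), fun s hs => h (t + s) (by omega)⟩
  · rintro ⟨h1, h2⟩ s hs
    by_cases h : s < t
    · exact h1 s h
    · have := h2 (s - t) (by omega)
      rwa [shift, Nat.add_sub_cancel' (by omega)] at this

/-- The event that `j` is visited at time `t`, not after the exit from `D`. -/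
def visit (D : Finset (Fin n)) (j : Fin n) (t : ℕ) : Set (ℕ → Fin n) :=
  stays D t ∩ {ω | ω t = j}

lemma dependsUpTo_visit (D : Finset (Fin n)) (j : Fin n) (t : ℕ) :
    DependsUpTo t (visit D j t) :=
  fun ω ω' h hω => ⟨dependsUpTo_stays D t ω ω' h hω.1, (h t le_rfl).symm.trans hω.2⟩

/-- The event that `j` is not visited at positive times up to the exit from `D`. -/
def noReturn (D : Finset (Fin n)) (j : Fin n) : Set (ℕ → Fin n) :=
  {ω | ∀ s, 0 < s → ω ∉ visit D j s}

lemma measurableSet_noReturn (D : Finset (Fin n)) (j : Fin n) :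
    MeasurableSet (noReturn D j) := by
  simp only [noReturn, Set.ofPred_forall]
  exact MeasurableSet.iInter fun s => MeasurableSet.iInter fun _ =>
    (dependsUpTo_visit D j s).measurableSet.compl

lemma greenX_eq_tsum_visit (Pr : Fin n → Measure (ℕ → Fin n)) (D : Finset (Fin n)) (ℓ j : Fin n) :
    greenX Pr D ℓ j = ∑' t, Pr ℓ (visit D j t) := by
  simp only [greenX, le_exitT_iff]
  rfl

lemma exitT_le_hitT_iff {D : Finset (Fin n)} {j : Fin n} {ω : ℕ → Fin n} (h0 : ω 0 = j) :
    exitT D ω ≤ hitT {j} ω ↔ ω ∈ noReturn D j := by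
  rw [hitT]
  simp only [le_iInf_iff, Set.mem_singleton_iff]
  constructor
  · rintro h s hs ⟨h1, h2⟩
    have h3 : ω 0 ∈ D := h1 0 hs
    have : ((s + 1 : ℕ) : ℕ∞) ≤ exitT D ω := by
      rw [le_exitT_iff]
      intro r hr
      rcases Nat.lt_succ_iff_lt_or_eq.1 hr with hr | rfl
      · exact h1 r hr
      · rw [show ω r = ω 0 from h2.trans h0.symm]; exact h3
    have := this.trans (h s ⟨hs, h2⟩)
    rw [Nat.cast_le] at this
    omega
  · rintro h s ⟨hs, h2⟩
    by_contra hlt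
    exact h s hs ⟨le_exitT_iff.1 (not_le.1 hlt).le, h2⟩

section Green

variable {P : Matrix (Fin n) (Fin n) ℝ} {Pr : Fin n → Measure (ℕ → Fin n)}

/-- Uniformly in the starting point, an irreducible chain may leave `D ≠ [n]` before a fixed
time. -/
lemma IsMarkovFamily.exists_stays_le (hPr : IsMarkovFamily P Pr) (hP : IsStochastic P)
    (hirr : IsIrreducible P) {D : Finset (Fin n)} (hD : D ≠ Finset.univ) :
    ∃ N, 0 < N ∧ ∃ c < 1, ∀ i, Pr i (stays D N) ≤ c := by
  obtain ⟨k, hk⟩ : ∃ k, k ∉ D := by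
    by_contra! h
    exact hD (Finset.eq_univ_of_forall h)
  choose m _ hm using fun i => hirr i k
  refine ⟨Finset.univ.sup m + 1, Nat.succ_pos _,
    Finset.univ.sup fun i => Pr i (stays D (Finset.univ.sup m + 1)), ?_,
    fun i => Finset.le_sup (f := fun i => Pr i (stays D (Finset.univ.sup m + 1)))
      (Finset.mem_univ i)⟩
  rw [Finset.sup_lt_iff (by simp)]
  intro i _
  have := hPr.1 i
  have hsub : stays D (Finset.univ.sup m + 1) ⊆ {ω | ω (m i) = k}ᶜ := by
    intro ω hω he
    refine hk ?_
    rw [← show ω (m i) = k from he]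
    exact hω _ (Nat.lt_succ_of_le (Finset.le_sup (Finset.mem_univ i)))
  refine (measure_mono hsub).trans_lt ?_
  rw [prob_compl_eq_one_sub (measurableSet_eval_eq _ _), hPr.measure_eval hP]
  exact ENNReal.sub_lt_self ENNReal.one_ne_top one_ne_zero (ENNReal.ofReal_pos.2 (hm i)).ne'

lemma IsMarkovFamily.stays_add_le (hPr : IsMarkovFamily P Pr) (hP : IsStochastic P)
    {D : Finset (Fin n)} {N : ℕ} {c : ℝ≥0∞} (hc : ∀ i, Pr i (stays D N) ≤ c) (i : Fin n) (t : ℕ) :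
    Pr i (stays D (t + N)) ≤ Pr i (stays D t) * c := by
  rw [measure_eq_sum_eval _ t, measure_eq_sum_eval _ t (stays D t), Finset.sum_mul]
  refine Finset.sum_le_sum fun k _ => ?_
  rw [stays_add, Set.inter_right_comm]
  change Pr i (visit D k t ∩ _) ≤ _
  rw [hPr.markov hP i k (dependsUpTo_visit D k t) (fun ω h => h.2)
    (dependsUpTo_stays D N).measurableSet]
  gcongr
  · exact le_rfl
  · exact hc k

lemma IsMarkovFamily.tsum_stays_ne_top (hPr : IsMarkovFamily P Pr) (hP : IsStochastic P)
    (hirr : IsIrreducible P) {D : Finset (Fin n)} (hD : D ≠ Finset.univ) (i : Fin n) :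
    ∑' t, Pr i (stays D t) ≠ ⊤ := by
  have := hPr.1 i
  obtain ⟨N, hN, c, hc1, hc⟩ := hPr.exists_stays_le hP hirr hD
  have hpow : ∀ q, Pr i (stays D (N * q)) ≤ c ^ q := by
    intro q
    induction q with
    | zero => simpa using prob_le_one
    | succ q ih =>
      rw [Nat.mul_succ, pow_succ]
      exact (hPr.stays_add_le hP hc i _).trans (by gcongr)
  have : NeZero N := ⟨hN.ne'⟩
  rw [← (Nat.divModEquiv N).symm.tsum_eq, ENNReal.summable.tsum_prod' fun _ => ENNReal.summable]
  have hle : ∑' q, ∑' r : Fin N, Pr i (stays D ((Nat.divModEquiv N).symm (q, r)))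
      ≤ ∑' q : ℕ, N * c ^ q := by
    refine ENNReal.tsum_le_tsum fun q => ?_
    rw [tsum_fintype]
    refine (Finset.sum_le_card_nsmul _ _ (c ^ q) fun r _ => ?_).trans (by simp)
    refine (measure_mono (stays_antitone D ?_)).trans (hpow q)
    simp [Nat.divModEquiv, mul_comm]
  refine ne_top_of_le_ne_top ?_ hle
  rw [ENNReal.tsum_mul_left, ENNReal.tsum_geometric]
  exact ENNReal.mul_ne_top (ENNReal.natCast_ne_top N)
    (ENNReal.inv_ne_top.2 (tsub_pos_of_lt hc1).ne')

lemma IsMarkovFamily.tsum_visit_ne_top (hPr : IsMarkovFamily P Pr) (hP : IsStochastic P)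
    (hirr : IsIrreducible P) {D : Finset (Fin n)} (hD : D ≠ Finset.univ) (i j : Fin n) :
    ∑' t, Pr i (visit D j t) ≠ ⊤ :=
  ne_top_of_le_ne_top (hPr.tsum_stays_ne_top hP hirr hD i)
    (ENNReal.tsum_le_tsum fun _ => measure_mono Set.inter_subset_left)

/-- On a visit at time `t`, no return after `t` means that the visit is the last one. -/
lemma mem_noReturn_shift_iff {D : Finset (Fin n)} {j : Fin n} {t : ℕ} {ω : ℕ → Fin n}
    (h : ω ∈ visit D j t) :
    ω ∈ shift t ⁻¹' noReturn D j ↔ ∀ s > t, ω ∉ visit D j s := by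
  have key : ∀ s, shift t ω ∈ visit D j s ↔ ω ∈ visit D j (t + s) := by
    intro s
    rw [visit, visit, stays_add]
    exact ⟨fun h' => ⟨⟨h.1, h'.1⟩, h'.2⟩, fun h' => ⟨h'.1.2, h'.2⟩⟩
  constructor
  · intro h' s hs hv
    refine h' (s - t) (by omega) ((key _).2 ?_)
    rwa [Nat.add_sub_cancel' hs.le]
  · exact fun h' s hs hv => h' (t + s) (by omega) ((key s).1 hv)

/-- Decomposition according to the last visit of `j` before the exit from `D`. -/
lemma IsMarkovFamily.measure_iUnion_visit (hPr : IsMarkovFamily P Pr) (hP : IsStochastic P)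
    {D : Finset (Fin n)} {i j : Fin n} (hfin : ∑' t, Pr i (visit D j t) ≠ ⊤) :
    Pr i (⋃ t, visit D j t) = (∑' t, Pr i (visit D j t)) * Pr j (noReturn D j) := by
  have hlast : ⋃ t, visit D j t =ᵐ[Pr i] ⋃ t, visit D j t ∩ shift t ⁻¹' noReturn D j := by
    filter_upwards [ae_eventually_notMem hfin] with ω hω
    refine propext ⟨fun h => ?_, fun h => ?_⟩
    · classical
      obtain ⟨t₀, ht₀⟩ := Set.mem_iUnion.1 h
      obtain ⟨M, hM⟩ := Filter.eventually_atTop.1 hω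
      have hb : ∀ t, ω ∈ visit D j t → t ≤ M :=
        fun t ht => by_contra fun h' => hM t (by omega) ht
      have hmem := Nat.findGreatest_spec (P := fun t => ω ∈ visit D j t) (hb t₀ ht₀) ht₀
      refine Set.mem_iUnion.2 ⟨_, hmem, (mem_noReturn_shift_iff hmem).2 fun s hs hv => ?_⟩
      exact Nat.findGreatest_is_greatest hs (hb s hv) hv
    · obtain ⟨t, ht⟩ := Set.mem_iUnion.1 h
      exact Set.mem_iUnion.2 ⟨t, ht.1⟩
  have hdisj : Pairwise (Function.onFun Disjoint
      fun t => visit D j t ∩ shift t ⁻¹' noReturn D j) := by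
    refine (pairwise_disjoint_on _).2 fun s t hst => Set.disjoint_left.2 ?_
    rintro ω ⟨h1, h2⟩ ⟨h3, -⟩
    exact (mem_noReturn_shift_iff h1).1 h2 t hst h3
  rw [measure_congr hlast, measure_iUnion hdisj fun t =>
    (dependsUpTo_visit D j t).measurableSet.inter
      (measurable_shift t (measurableSet_noReturn D j)), ← ENNReal.tsum_mul_right]
  exact tsum_congr fun t => hPr.markov hP i j (dependsUpTo_visit D j t) (fun ω h => h.2)
    (measurableSet_noReturn D j)

end Green

/-- Eq. (21) of the paper: for `ℓ, j ∈ [n]`,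
`E_ℓ[∑_{t≤T} 1{X_t = j}] = P_ℓ[∃ t ≤ T, X_t = j] / P_j[T ≤ T_j]`, the denominator being
strictly positive and both sides finite. -/
theorem stmt12 {n : ℕ} (hn : 2 ≤ n) (D : Finset (Fin n)) (hD : D.Nonempty)
    (hDne : D ≠ Finset.univ)
    (P : Matrix (Fin n) (Fin n) ℝ) (hP : IsStochastic P) (hirr : IsIrreducible P)
    (Pr : Fin n → Measure (ℕ → Fin n)) (hPr : IsMarkovFamily P Pr)
    (ℓ j : Fin n) :
    0 < Pr j {ω | exitT D ω ≤ hitT {j} ω} ∧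
    greenX Pr D ℓ j ≠ ⊤ ∧
    greenX Pr D ℓ j
      = Pr ℓ {ω | ∃ t : ℕ, (t : ℕ∞) ≤ exitT D ω ∧ ω t = j} /
          Pr j {ω | exitT D ω ≤ hitT {j} ω} := by
  have hG : ∀ i, greenX Pr D i j ≠ ⊤ := fun i =>
    greenX_eq_tsum_visit Pr D i j ▸ hPr.tsum_visit_ne_top hP hirr hDne i j
  have hprod : ∀ i, Pr i (⋃ t, visit D j t) = greenX Pr D i j * Pr j (noReturn D j) := fun i =>
    greenX_eq_tsum_visit Pr D i j ▸
      hPr.measure_iUnion_visit hP (hPr.tsum_visit_ne_top hP hirr hDne i j)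
  have := hPr.1 j
  have hstart : ∀ᵐ ω ∂Pr j, ω 0 = j := by
    rw [ae_iff]
    exact (prob_compl_eq_zero_iff (measurableSet_eval_eq 0 j)).2
      (by rw [hPr.measure_start hP, if_pos rfl])
  have hden : Pr j {ω | exitT D ω ≤ hitT {j} ω} = Pr j (noReturn D j) := by
    refine measure_congr ?_
    filter_upwards [hstart] with ω hω
    exact propext (exitT_le_hitT_iff hω)
  have hnum : {ω : ℕ → Fin n | ∃ t : ℕ, (t : ℕ∞) ≤ exitT D ω ∧ ω t = j}
      = ⋃ t, visit D j t := by
    ext ω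
    simp only [le_exitT_iff, Set.mem_iUnion]
    rfl
  have hone : Pr j (⋃ t, visit D j t) ≠ 0 := by
    refine (lt_of_lt_of_le ?_ (measure_mono (Set.subset_iUnion _ 0))).ne'
    have : visit D j 0 = {ω | ω 0 = j} := by
      ext ω
      simp [visit, stays]
    rw [this, hPr.measure_start hP, if_pos rfl]
    exact one_pos
  have hpos : Pr j (noReturn D j) ≠ 0 := fun h => hone (by rw [hprod, h, mul_zero])
  rw [hden, hnum]
  refine ⟨pos_iff_ne_zero.2 hpos, hG ℓ, ?_⟩
  rw [ENNReal.eq_div_iff hpos (measure_ne_top _ _), hprod, mul_comm]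

end RareTD
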